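/- Let 𝕂 be a field, N a finite set, Γ a principally regular symmetric matrix over 𝕂 indexed by N, Z ⊆ N, and δ : N → {+1, −1}. Define diagonal matrices A, B, C, D indexed by N by: A_{ii} = D_{ii} = δ_i and B_{ii} = C_{ii} = 0 for i ∉ Z; C_{ii} = δ_i, B_{ii} = −δ_i and A_{ii} = D_{ii} = 0 for i ∈ Z. Then A + ΓC is invertible, and Γ' = (A + ΓC)^{−1}(B + ΓD) is a principally regular symmetric matrix over 𝕂 whose minors satisfy, for all K ⊆ N and all CI statements (ij|K) ∈ A_N: det Γ'_K = (−1)^{|Z∩K|} (det Γ_Z)^{−1} · det Γ_{Z⊕K}, and det Γ'_{ij|K} = (−1)^{|Z∩K|} (det Γ_Z)^{−1} · δ_i δ_j · det Γ_{ij|(Z∖{i,j})⊕K}, where ⊕ denotes symmetric difference. Consequently CIS(Γ') = {(ij|(Z∖{i,j})⊕K) : (ij|K) ∈ CIS(Γ)}. -/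

import Mathlib

open scoped symmDiff

abbrev CIStmt (N : Type*) := Sym2 N × Finset N

def CIStmt.proper {N : Type*} (s : CIStmt N) : Prop :=
  ¬ s.1.IsDiag ∧ ∀ i ∈ s.1, i ∉ s.2

variable {N : Type*} [DecidableEq N]

def pminor {R : Type*} [CommRing R] (M : Matrix N N R) (S : Finset N) : R :=
  (M.submatrix (fun a : S => (a : N)) (fun a : S => (a : N))).det

def apminor {R : Type*} [CommRing R] (M : Matrix N N R) (i j : N) (K : Finset N) : R :=
  (Matrix.of fun a b : Unit ⊕ ↥K =>
      M (Sum.elim (fun _ => i) (fun k => (k : N)) a)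
        (Sum.elim (fun _ => j) (fun k => (k : N)) b)).det

def PrinReg {R : Type*} [CommRing R] (M : Matrix N N R) : Prop :=
  ∀ S : Finset N, pminor M S ≠ 0

def PosDefMinors {R : Type*} [Field R] [LinearOrder R] [IsStrictOrderedRing R] (M : Matrix N N R) : Prop :=
  ∀ S : Finset N, 0 < pminor M S

def CIS {R : Type*} [CommRing R] (M : Matrix N N R) : Set (CIStmt N) :=
  {s | s.proper ∧ ∀ i j : N, s.1 = s(i, j) → apminor M i j s.2 = 0}

def IsGaussoid (G : Set (CIStmt N)) : Prop :=
  (∀ s ∈ G, s.proper) ∧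
  ∀ i j k : N, ∀ L : Finset N,
    i ≠ j → i ≠ k → j ≠ k → i ∉ L → j ∉ L → k ∉ L →
      (((s(i,j), L) ∈ G ∧ (s(i,k), insert j L) ∈ G) ↔
        ((s(i,k), L) ∈ G ∧ (s(i,j), insert k L) ∈ G)) ∧
      (((s(i,j), insert k L) ∈ G ∧ (s(i,k), insert j L) ∈ G) ↔
        ((s(i,j), L) ∈ G ∧ (s(i,k), L) ∈ G)) ∧
      (((s(i,j), L) ∈ G ∧ (s(i,j), insert k L) ∈ G) →
        ((s(i,k), L) ∈ G ∨ (s(j,k), L) ∈ G))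


/-- `M` with the columns outside `S` replaced by those of `P`. -/
def mixCols {R : Type*} (P M : Matrix N N R) (S : Finset N) : Matrix N N R :=
  Matrix.of fun a m => if m ∈ S then M a m else P a m

lemma det_mixCols_one {R : Type*} [CommRing R] [Fintype N] (M : Matrix N N R) (S : Finset N) :
    (mixCols 1 M S).det = pminor M S := by
  rw [Matrix.twoBlockTriangular_det' (mixCols 1 M S) (fun i => i ∈ S)]
  · have h2 : (Matrix.toSquareBlockProp (mixCols 1 M S) (fun i => ¬ i ∈ S)) = 1 := by
      ext a b
      have hb := b.2
      simp [Matrix.toSquareBlockProp, mixCols, hb, Matrix.one_apply, Subtype.ext_iff]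
    have h1 : (Matrix.toSquareBlockProp (mixCols 1 M S) (fun i => i ∈ S))
        = M.submatrix (fun a : S => (a : N)) (fun a : S => (a : N)) := by
      ext a b
      have hb := b.2
      simp [Matrix.toSquareBlockProp, mixCols, hb]
    rw [h2, Matrix.det_one, mul_one, h1]
    unfold pminor
    congr!
  · intro i hi j hj
    have : i ≠ j := fun h => hj (h ▸ hi)
    simp [mixCols, hj, Matrix.one_apply, this]

lemma det_mixCols_of_mul {R : Type*} [CommRing R] [Fintype N] (P Q G : Matrix N N R)
    (h : P * G = Q) (S : Finset N) :
    (mixCols P Q S).det = P.det * pminor G S := by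
  rw [← det_mixCols_one, ← Matrix.det_mul]
  congr 1
  ext a m
  by_cases hm : m ∈ S
  · simp [mixCols, hm, ← h, Matrix.mul_apply]
  · simp [mixCols, hm, Matrix.mul_apply, Matrix.one_apply]

/-- `M` with column `i` replaced by column `j`. -/
def repCol {R : Type*} (M : Matrix N N R) (i j : N) : Matrix N N R :=
  Matrix.of fun a m => M a (if m = i then j else m)

lemma mul_repCol {R : Type*} [CommRing R] [Fintype N] (P Q G : Matrix N N R)
    (h : P * G = Q) (i j : N) : P * repCol G i j = repCol Q i j := by
  ext a m
  simp [repCol, ← h, Matrix.mul_apply]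

lemma repCol_self {R : Type*} (M : Matrix N N R) (i j a : N) : repCol M i j a i = M a j := by
  simp [repCol]

lemma repCol_ne {R : Type*} (M : Matrix N N R) (i j a m : N) (h : m ≠ i) :
    repCol M i j a m = M a m := by
  simp [repCol, h]

lemma apminor_eq {R : Type*} [CommRing R] (M : Matrix N N R) (i j : N) (K : Finset N)
    (hi : i ∉ K) : apminor M i j K = pminor (repCol M i j) (insert i K) := by
  unfold apminor pminor
  let f : Unit ⊕ ↥K → ↥(insert i K) := fun x =>
    Sum.elim (fun _ => ⟨i, by simp⟩) (fun k : ↥K => ⟨(k : N), by simp⟩) x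
  have hf : Function.Bijective f := by
    constructor
    · rintro (a | ⟨a, ha⟩) (b | ⟨b, hb⟩) hab
      · rfl
      · simp [f] at hab; subst hab; exact absurd hb hi
      · simp [f] at hab; subst hab; exact absurd ha hi
      · simp [f] at hab; subst hab; rfl
    · rintro ⟨x, hx⟩
      rcases Finset.mem_insert.1 hx with h | h
      · exact ⟨Sum.inl (), by simp [f, h]⟩
      · exact ⟨Sum.inr ⟨x, h⟩, by simp [f]⟩
  rw [← Matrix.det_submatrix_equiv_self (Equiv.ofBijective f hf)]
  congr 1
  ext a b
  rcases a with a | a <;> rcases b with b | b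
  · exact (repCol_self M i j i).symm
  · have : (b : N) ≠ i := fun h => hi (h ▸ b.2)
    exact (repCol_ne M i j i b this).symm
  · exact (repCol_self M i j a).symm
  · have : (b : N) ≠ i := fun h => hi (h ▸ b.2)
    exact (repCol_ne M i j a b this).symm

lemma apminor_symm {R : Type*} [CommRing R] (M : Matrix N N R) (h : M.IsSymm) (i j : N)
    (K : Finset N) : apminor M i j K = apminor M j i K := by
  unfold apminor
  rw [← Matrix.det_transpose]
  congr 1
  ext a b
  simp only [Matrix.transpose_apply, Matrix.of_apply]
  exact h.apply _ _

lemma apminor_empty {R : Type*} [CommRing R] (M : Matrix N N R) (i j : N) :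
    apminor M i j ∅ = M i j := by
  unfold apminor
  rw [Matrix.det_eq_elem_of_card_eq_one (by simp) (Sum.inl ())]
  rfl

lemma mem_CIS {R : Type*} [CommRing R] (M : Matrix N N R) (h : M.IsSymm) (i j : N)
    (K : Finset N) :
    ((s(i, j), K) : CIStmt N) ∈ CIS M ↔ i ≠ j ∧ i ∉ K ∧ j ∉ K ∧ apminor M i j K = 0 := by
  simp only [CIS, CIStmt.proper, Set.mem_ofPred_eq, Sym2.mk_isDiag_iff, Sym2.mem_iff]
  constructor
  · rintro ⟨⟨h1, h2⟩, h3⟩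
    exact ⟨h1, h2 i (Or.inl rfl), h2 j (Or.inr rfl), h3 i j rfl⟩
  · rintro ⟨h1, h2, h3, h4⟩
    refine ⟨⟨h1, ?_⟩, ?_⟩
    · rintro k (rfl | rfl) <;> assumption
    · intro a b hab
      rcases Sym2.eq_iff.1 hab with ⟨rfl, rfl⟩ | ⟨rfl, rfl⟩
      · exact h4
      · rw [apminor_symm M h]; exact h4

lemma prod_neg_ite {R : Type*} [CommRing R] [Fintype N] (S : Finset N) :
    (∏ m : N, if m ∈ S then (-1 : R) else 1) = (-1) ^ S.card := by
  rw [Finset.prod_ite_mem]; simp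

/-- the hyperoctahedral action on principally regular symmetric matrices
and its effect on principal and almost-principal minors. -/
theorem stmt4 {N : Type*} [Fintype N] [DecidableEq N] {𝕂 : Type*} [Field 𝕂]
    (Γ : Matrix N N 𝕂) (hsym : Γ.IsSymm) (hpr : PrinReg Γ)
    (Z : Finset N) (δ : N → 𝕂) (hδ : ∀ i, δ i = 1 ∨ δ i = -1)
    (A B C D : Matrix N N 𝕂)
    (hA : A = Matrix.diagonal (fun i => if i ∈ Z then 0 else δ i))
    (hB : B = Matrix.diagonal (fun i => if i ∈ Z then -δ i else 0))
    (hC : C = Matrix.diagonal (fun i => if i ∈ Z then δ i else 0))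
    (hD : D = Matrix.diagonal (fun i => if i ∈ Z then 0 else δ i)) :
    IsUnit (A + Γ * C) ∧
    ((A + Γ * C)⁻¹ * (B + Γ * D)).IsSymm ∧
    PrinReg ((A + Γ * C)⁻¹ * (B + Γ * D)) ∧
    (∀ K : Finset N, pminor ((A + Γ * C)⁻¹ * (B + Γ * D)) K
        = (-1 : 𝕂) ^ (Z ∩ K).card * (pminor Γ Z)⁻¹ * pminor Γ (Z ∆ K)) ∧
    (∀ i j : N, ∀ K : Finset N, i ≠ j → i ∉ K → j ∉ K →
      apminor ((A + Γ * C)⁻¹ * (B + Γ * D)) i j K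
        = (-1 : 𝕂) ^ (Z ∩ K).card * (pminor Γ Z)⁻¹ * (δ i * δ j)
            * apminor Γ i j ((Z \ {i, j}) ∆ K)) ∧
    CIS ((A + Γ * C)⁻¹ * (B + Γ * D))
      = {t : CIStmt N | ∃ i j : N, ∃ K : Finset N,
          (s(i, j), K) ∈ CIS Γ ∧ t = (s(i, j), (Z \ {i, j}) ∆ K)} := by
  have hδ2 : ∀ i, δ i * δ i = 1 := fun i => by rcases hδ i with h | h <;> simp [h]
  have hprod : (∏ m, δ m) ≠ 0 := Finset.prod_ne_zero_iff.2 fun i _ h0 => by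
    have := hδ2 i; simp [h0] at this
  have hP : ∀ a m, (A + Γ * C) a m = δ m * (if m ∈ Z then Γ a m else (1 : Matrix N N 𝕂) a m) := by
    intro a m
    subst hA hC
    by_cases hm : m ∈ Z
    · by_cases ha : a = m
      · subst ha; simp [hm, mul_comm]
      · simp [hm, ha, mul_comm]
    · by_cases ha : a = m
      · subst ha; simp [hm]
      · simp [hm, ha]
  have hQ : ∀ a m, (B + Γ * D) a m = δ m * (if m ∈ Z then -(1 : Matrix N N 𝕂) a m else Γ a m) := by
    intro a m
    subst hB hD
    by_cases hm : m ∈ Z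
    · by_cases ha : a = m
      · subst ha; simp [hm]
      · simp [hm, ha]
    · by_cases ha : a = m
      · subst ha; simp [hm, mul_comm]
      · simp [hm, ha, mul_comm]
  clear hA hB hC hD
  generalize A + Γ * C = P at *
  generalize B + Γ * D = Q at *
  have hdetP : P.det = (∏ m, δ m) * pminor Γ Z := by
    rw [← det_mixCols_one, ← Matrix.det_mul_row]
    congr 1
    ext a m
    simp [mixCols, hP]
  have hdet0 : P.det ≠ 0 := by rw [hdetP]; exact mul_ne_zero hprod (hpr Z)
  have hU : IsUnit P := (Matrix.isUnit_iff_isUnit_det P).2 (isUnit_iff_ne_zero.2 hdet0)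
  have hPG : P * (P⁻¹ * Q) = Q := by
    rw [← Matrix.mul_assoc, Matrix.mul_nonsing_inv _ (isUnit_iff_ne_zero.2 hdet0), Matrix.one_mul]
  generalize P⁻¹ * Q = G at *
  have hpm : ∀ K : Finset N, pminor G K
        = (-1 : 𝕂) ^ (Z ∩ K).card * (pminor Γ Z)⁻¹ * pminor Γ (Z ∆ K) := by
    intro K
    have h1 := det_mixCols_of_mul P Q G hPG K
    have h2 : (mixCols P Q K).det =
        (∏ m, (δ m * if m ∈ Z ∩ K then (-1 : 𝕂) else 1)) * pminor Γ (Z ∆ K) := by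
      rw [← det_mixCols_one, ← Matrix.det_mul_row]
      congr 1
      ext a m
      by_cases hz : m ∈ Z <;> by_cases hk : m ∈ K <;>
        simp [mixCols, hP, hQ, hz, hk, Finset.mem_symmDiff]
    rw [Finset.prod_mul_distrib, prod_neg_ite] at h2
    rw [h2, hdetP] at h1
    have := hpr Z
    field_simp
    apply mul_left_cancel₀ hprod
    linear_combination -h1
  have hap : ∀ i j : N, ∀ K : Finset N, i ≠ j → i ∉ K → j ∉ K →
      apminor G i j K
        = (-1 : 𝕂) ^ (Z ∩ K).card * (pminor Γ Z)⁻¹ * (δ i * δ j)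
            * apminor Γ i j ((Z \ {i, j}) ∆ K) := by
    intro i j K hij hi hj
    have hiT : i ∉ (Z \ {i, j}) ∆ K := by simp [Finset.mem_symmDiff, hi]
    rw [apminor_eq G i j K hi, apminor_eq Γ i j _ hiT]
    have h1 := det_mixCols_of_mul P (repCol Q i j) (repCol G i j) (mul_repCol P Q G hPG i j)
      (insert i K)
    have h2 : (mixCols P (repCol Q i j) (insert i K)).det = (∏ m, δ m) * (δ i * δ j) *
        (-1) ^ (Z ∩ K).card * pminor (repCol Γ i j) (insert i ((Z \ {i, j}) ∆ K)) := by
      by_cases hjZ : j ∈ Z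
      · have hv : (∏ m, (δ m * (if m = i then δ i * δ j else 1) *
            (if m ∈ Z ∩ K then (-1 : 𝕂) else 1) * (if m = j then -1 else 1))) =
            -((∏ m, δ m) * (δ i * δ j) * (-1) ^ (Z ∩ K).card) := by
          rw [Finset.prod_mul_distrib, Finset.prod_mul_distrib, Finset.prod_mul_distrib,
            prod_neg_ite]
          simp
        have hs := Matrix.det_permute' (Equiv.swap i j) (mixCols P (repCol Q i j) (insert i K))
        rw [Equiv.Perm.sign_swap hij] at hs
        have h3 : ((mixCols P (repCol Q i j) (insert i K)).submatrix id (Equiv.swap i j)).det =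
            -((∏ m, δ m) * (δ i * δ j) * (-1) ^ (Z ∩ K).card) *
              pminor (repCol Γ i j) (insert i ((Z \ {i, j}) ∆ K)) := by
          rw [← hv, ← det_mixCols_one, ← Matrix.det_mul_row]
          congr 1
          ext a m
          by_cases hmi : m = i
          · subst hmi
            simp [mixCols, repCol_self, repCol_ne, hP, hQ, hij, hij.symm, hi, hj, hjZ, ← mul_assoc, hδ2]
          · by_cases hmj : m = j
            · subst hmj
              simp [mixCols, repCol_self, repCol_ne, hP, hQ, hij, hij.symm, hi, hj, hjZ, Finset.mem_symmDiff]
            · by_cases hz : m ∈ Z <;> by_cases hk : m ∈ K <;>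
                simp [mixCols, repCol_ne, hP, hQ, hmi, hmj, hz, hk, Finset.mem_symmDiff,
                  Equiv.swap_apply_of_ne_of_ne]
        rw [h3] at hs
        push_cast at hs
        linear_combination hs
      · have hv : (∏ m, (δ m * (if m = i then δ i * δ j else 1) *
            (if m ∈ Z ∩ K then (-1 : 𝕂) else 1))) =
            ((∏ m, δ m) * (δ i * δ j) * (-1) ^ (Z ∩ K).card) := by
          rw [Finset.prod_mul_distrib, Finset.prod_mul_distrib, prod_neg_ite]
          simp
        rw [← hv, ← det_mixCols_one, ← Matrix.det_mul_row]
        congr 1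
        ext a m
        by_cases hmi : m = i
        · subst hmi
          simp [mixCols, repCol_self, repCol_ne, hP, hQ, hi, hj, hjZ, ← mul_assoc, hδ2]
        · by_cases hmj : m = j
          · subst hmj
            simp [mixCols, repCol_self, repCol_ne, hP, hQ, hij.symm, hi, hj, hjZ, Finset.mem_symmDiff]
          · by_cases hz : m ∈ Z <;> by_cases hk : m ∈ K <;>
              simp [mixCols, repCol_ne, hP, hQ, hmi, hmj, hz, hk, Finset.mem_symmDiff]
    rw [h2, hdetP] at h1
    have := hpr Z
    field_simp
    apply mul_left_cancel₀ hprod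
    linear_combination -h1
  have hGs : G.IsSymm := by
    ext i j
    rw [Matrix.transpose_apply]
    by_cases hij : i = j
    · rw [hij]
    · rw [← apminor_empty G j i, ← apminor_empty G i j,
        hap i j ∅ hij (by simp) (by simp), hap j i ∅ (Ne.symm hij) (by simp) (by simp),
        apminor_symm Γ hsym i j, Finset.pair_comm, mul_comm (δ i)]
  have hδ0 : ∀ i, δ i ≠ 0 := fun i h0 => by have := hδ2 i; simp [h0] at this
  have hap0 : ∀ i j : N, ∀ K : Finset N, i ≠ j → i ∉ K → j ∉ K →
      (apminor G i j K = 0 ↔ apminor Γ i j ((Z \ {i, j}) ∆ K) = 0) := by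
    intro i j K hij hi hj
    rw [hap i j K hij hi hj]
    have := hpr Z
    simp [hδ0, this]
  refine ⟨hU, hGs, ?_, hpm, hap, ?_⟩
  · intro S
    rw [hpm S]
    have h1 := hpr Z
    have h2 := hpr (Z ∆ S)
    simp [h1, h2]
  · ext ⟨e, K⟩
    induction e using Sym2.ind with
    | _ i j =>
    rw [mem_CIS G hGs]
    constructor
    · rintro ⟨hij, hi, hj, h0⟩
      refine ⟨i, j, (Z \ {i, j}) ∆ K, (mem_CIS Γ hsym _ _ _).2 ⟨hij, ?_, ?_, ?_⟩, ?_⟩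
      · simp [Finset.mem_symmDiff, hi]
      · simp [Finset.mem_symmDiff, hj]
      · exact (hap0 i j K hij hi hj).1 h0
      · rw [symmDiff_symmDiff_cancel_left]
    · rintro ⟨a, b, L, hL, ht⟩
      obtain ⟨hab, ha, hb, h0⟩ := (mem_CIS Γ hsym _ _ _).1 hL
      rw [← mem_CIS G hGs, ht, mem_CIS G hGs]
      have ha' : a ∉ (Z \ {a, b}) ∆ L := by simp [Finset.mem_symmDiff, ha]
      have hb' : b ∉ (Z \ {a, b}) ∆ L := by simp [Finset.mem_symmDiff, hb]
      refine ⟨hab, ha', hb', (hap0 a b _ hab ha' hb').2 ?_⟩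
      rw [symmDiff_symmDiff_cancel_left]
      exact h0
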